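/- arXiv:2009.08234 — 2 statements merged into one kernel-verified Lean document; each statement's English description precedes it below -/
import Mathlib

section
/- Let g : [0,τ] → ℝ be measurable with g(0) = g(τ) (in the sense that g extends τ-periodically to a measurable function on ℝ), let 2 < r < ∞, and suppose the Gagliardo seminorm ⟨g⟩_{1−1/r,r;[0,τ]}^r = ∫_0^τ∫_0^τ |g(y)−g(z)|^r/|y−z|^r dy dz is finite and g is continuous at 0 and τ with g(0)=g(τ). Then the τ-periodic extension g̃ of g to [0,2τ] satisfies ⟨g̃⟩_{1−1/r,r;[0,2τ]}^r ≤ C ⟨g⟩_{1−1/r,r;[0,τ]}^r for a constant C depending only on r and τ. -/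
open MeasureTheory Set

lemma aux_two_pt (r Q : ℝ) (hr : 2 < r) (hQ : 1 < Q) :
    ∃ K > (0:ℝ), ∀ a b : ℝ, 0 ≤ a → 0 ≤ b → (a + b) ^ r ≤ K * a ^ r + Q * b ^ r := by
  set q : ℝ := Q ^ (1 / (1 - r)) with hq
  have hq0 : 0 < q := by positivity
  have hq1 : q < 1 := Real.rpow_lt_one_of_one_lt_of_neg hQ (by
    apply div_neg_of_pos_of_neg <;> linarith)
  have hQq : Q = q ^ (1 - r) := by
    rw [hq, ← Real.rpow_mul (by linarith), div_mul_cancel₀ _ (by linarith), Real.rpow_one]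
  have h1q : 0 < 1 - q := by linarith
  refine ⟨(1 - q) ^ (1 - r), by positivity, fun a b ha hb => ?_⟩
  have h := (convexOn_rpow (p := r) (by linarith)).2 (x := a / (1 - q)) (y := b / q)
    (by simp only [mem_Ici]; positivity) (by simp only [mem_Ici]; positivity) h1q.le hq0.le (by ring)
  simp only [smul_eq_mul] at h
  rw [mul_div_cancel₀ _ h1q.ne', mul_div_cancel₀ _ hq0.ne', Real.div_rpow ha h1q.le,
    Real.div_rpow hb hq0.le] at h
  rw [hQq, Real.rpow_sub h1q, Real.rpow_sub hq0, Real.rpow_one, Real.rpow_one]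
  calc _ ≤ _ := h
    _ = _ := by ring

lemma aux_scale (F : ℝ → ENNReal) (a : ℝ) (ha : 0 < a) :
    ∫⁻ x, F (a * x) = ENNReal.ofReal a⁻¹ * ∫⁻ x, F x := by
  have h := lintegral_map_equiv (μ := volume) F (Homeomorph.mulLeft₀ a ha.ne').toMeasurableEquiv
  have h2 : (⇑(Homeomorph.mulLeft₀ a ha.ne').toMeasurableEquiv) = fun x : ℝ => a * x := rfl
  rw [h2, Real.map_volume_mul_left ha.ne', lintegral_smul_measure, abs_of_pos (by positivity)] at h
  exact h.symm

lemma aux_dil (r L : ℝ) (f : ℝ → ℝ) (a : ℝ) (ha : 0 < a) (ha1 : a ≤ 1) :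
    ∫⁻ w in Ioo (0:ℝ) L, ENNReal.ofReal (f (a * w) * w ^ (1 - r)) ≤
      ENNReal.ofReal (a ^ (r - 2)) * ∫⁻ w in Ioo (0:ℝ) L, ENNReal.ofReal (f w * w ^ (1 - r)) := by
  set G : ℝ → ENNReal := (Ioo (0:ℝ) L).indicator (fun w => ENNReal.ofReal (f w * w ^ (1 - r)))
  calc _ ≤ ∫⁻ w, ENNReal.ofReal (a ^ (r - 1)) * G (a * w) := by
        rw [← lintegral_indicator measurableSet_Ioo]
        apply lintegral_mono
        intro w
        by_cases hw : w ∈ Ioo (0:ℝ) L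
        · have hw2 : a * w ∈ Ioo (0:ℝ) L := ⟨mul_pos ha hw.1, by nlinarith [hw.1, hw.2]⟩
          simp only [G, indicator_of_mem hw, indicator_of_mem hw2]
          rw [← ENNReal.ofReal_mul (by positivity)]
          apply ENNReal.ofReal_le_ofReal
          rw [Real.mul_rpow ha.le hw.1.le]
          have : a ^ (r - 1) * a ^ (1 - r) = 1 := by
            rw [← Real.rpow_add ha]; simp
          apply le_of_eq
          linear_combination (-f (a * w) * w ^ (1 - r)) * this
        · simp [indicator_of_notMem hw]
    _ = _ := by
        rw [lintegral_const_mul' _ _ ENNReal.ofReal_ne_top, aux_scale G a ha, ← mul_assoc,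
          ← ENNReal.ofReal_mul (by positivity), ← lintegral_indicator measurableSet_Ioo]
        congr 2
        rw [← Real.rpow_neg_one, ← Real.rpow_add ha]
        congr 1; ring

lemma aux_chain (r Q K : ℝ) (hr : 2 < r) (hQ : 1 < Q) (hK : 0 < K)
    (h : ∀ a b : ℝ, 0 ≤ a → 0 ≤ b → (a + b) ^ r ≤ K * a ^ r + Q * b ^ r)
    (g : ℝ → ℝ) (t : ℝ) (n : ℕ) : ∀ w : ℝ,
    |g w - g (t ^ n * w)| ^ r ≤
      ∑ k ∈ Finset.range n, K * Q ^ k * |g (t ^ k * w) - g (t * (t ^ k * w))| ^ r := by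
  induction n with
  | zero => intro w; simp [Real.zero_rpow (by linarith : r ≠ 0)]
  | succ n ih =>
    intro w
    have h1 : |g w - g (t ^ (n + 1) * w)| ≤
        |g w - g (t * w)| + |g (t * w) - g (t ^ n * (t * w))| := by
      rw [show t ^ (n + 1) * w = t ^ n * (t * w) by ring]
      exact abs_sub_le _ _ _
    calc _ ≤ (|g w - g (t * w)| + |g (t * w) - g (t ^ n * (t * w))|) ^ r :=
          Real.rpow_le_rpow (abs_nonneg _) h1 (by linarith)
      _ ≤ _ := h _ _ (abs_nonneg _) (abs_nonneg _)
      _ ≤ _ := add_le_add_right (mul_le_mul_of_nonneg_left (ih (t * w)) (by linarith)) _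
      _ = _ := by
        rw [Finset.sum_range_succ', add_comm, Finset.mul_sum]
        congr 1
        · apply Finset.sum_congr rfl
          intro k _
          rw [show t ^ (k + 1) * w = t ^ k * (t * w) by ring]
          ring
        · simp

lemma aux_ptw (r Q K : ℝ) (hr : 2 < r) (hQ : 1 < Q) (hK : 0 < K)
    (h : ∀ a b : ℝ, 0 ≤ a → 0 ≤ b → (a + b) ^ r ≤ K * a ^ r + Q * b ^ r)
    (g : ℝ → ℝ) (hg : ContinuousAt g 0) (t : ℝ) (ht0 : 0 < t) (ht1 : t < 1) (w : ℝ) :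
    ENNReal.ofReal (|g w - g 0| ^ r) ≤
      ∑' k : ℕ, ENNReal.ofReal (K * Q ^ k * |g (t ^ k * w) - g (t * (t ^ k * w))| ^ r) := by
  have h0 : Filter.Tendsto (fun n : ℕ => t ^ n * w) Filter.atTop (nhds 0) := by
    simpa using (tendsto_pow_atTop_nhds_zero_of_lt_one ht0.le ht1).mul_const w
  have h1 : Filter.Tendsto (fun n : ℕ => ENNReal.ofReal (|g w - g (t ^ n * w)| ^ r)) Filter.atTop
      (nhds (ENNReal.ofReal (|g w - g 0| ^ r))) := by
    apply ENNReal.tendsto_ofReal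
    apply Filter.Tendsto.rpow_const
    · exact (tendsto_const_nhds.sub (hg.tendsto.comp h0)).abs
    · right; linarith
  apply le_of_tendsto' h1
  intro n
  calc _ ≤ _ := ENNReal.ofReal_le_ofReal (aux_chain r Q K hr hQ hK h g t n w)
    _ = _ := ENNReal.ofReal_sum_of_nonneg (fun k _ => by positivity)
    _ ≤ _ := ENNReal.sum_le_tsum _

lemma aux_hardy_t (r : ℝ) (hr : 2 < r) : ∃ C > (0:ℝ), ∀ g : ℝ → ℝ, Measurable g →
    ContinuousAt g 0 → ∀ t L : ℝ, 0 < t → t < 1 / 2 →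
    ∫⁻ w in Ioo (0:ℝ) L, ENNReal.ofReal (|g w - g 0| ^ r * w ^ (1 - r)) ≤
      ENNReal.ofReal C *
        ∫⁻ w in Ioo (0:ℝ) L, ENNReal.ofReal (|g w - g (t * w)| ^ r * w ^ (1 - r)) := by
  set Q : ℝ := 2 ^ ((r - 2) / 2) with hQd
  have hQ : 1 < Q := Real.one_lt_rpow (by norm_num) (by linarith)
  have hQ0 : 0 < Q := by linarith
  obtain ⟨K, hK, h⟩ := aux_two_pt r Q hr hQ
  have hρ1 : Q⁻¹ < 1 := inv_lt_one_of_one_lt₀ hQ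
  have hρ0 : 0 < Q⁻¹ := by positivity
  refine ⟨K * (1 - Q⁻¹)⁻¹, mul_pos hK (inv_pos.2 (by linarith)), ?_⟩
  intro g hgm hg t L ht0 ht1
  set D := ∫⁻ w in Ioo (0:ℝ) L, ENNReal.ofReal (|g w - g (t * w)| ^ r * w ^ (1 - r))
  have hρ : Q * t ^ (r - 2) ≤ Q⁻¹ := by
    have h1 : t ^ (r - 2) ≤ (1 / 2 : ℝ) ^ (r - 2) :=
      Real.rpow_le_rpow ht0.le ht1.le (by linarith)
    have h2 : (1 / 2 : ℝ) ^ (r - 2) = Q⁻¹ * Q⁻¹ := by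
      rw [one_div, Real.inv_rpow (by norm_num), ← mul_inv, hQd,
        ← Real.rpow_add (by norm_num)]
      congr 2; ring
    calc _ ≤ Q * (Q⁻¹ * Q⁻¹) := mul_le_mul_of_nonneg_left (h1.trans h2.le) hQ0.le
      _ = _ := by field_simp
  calc _ ≤ ∫⁻ w in Ioo (0:ℝ) L, ∑' k : ℕ, ENNReal.ofReal (K * Q ^ k) *
        ENNReal.ofReal (|g (t ^ k * w) - g (t * (t ^ k * w))| ^ r * w ^ (1 - r)) := by
        apply setLIntegral_mono' measurableSet_Ioo
        intro w hw
        have hw0 : 0 < w := hw.1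
        rw [ENNReal.ofReal_mul (by positivity)]
        calc _ ≤ _ := mul_le_mul_left (aux_ptw r Q K hr hQ hK h g hg t ht0 (by linarith) w) _
          _ = _ := by
            rw [← ENNReal.tsum_mul_right]
            congr 1; ext k
            rw [← ENNReal.ofReal_mul (by positivity), ← ENNReal.ofReal_mul (by positivity), mul_assoc]
    _ = ∑' k : ℕ, ∫⁻ w in Ioo (0:ℝ) L, ENNReal.ofReal (K * Q ^ k) *
        ENNReal.ofReal (|g (t ^ k * w) - g (t * (t ^ k * w))| ^ r * w ^ (1 - r)) := by
        apply lintegral_tsum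
        intro k
        apply Measurable.aemeasurable
        fun_prop
    _ ≤ ∑' k : ℕ, ENNReal.ofReal K * D * ENNReal.ofReal (Q⁻¹) ^ k := by
        apply ENNReal.tsum_le_tsum
        intro k
        rw [lintegral_const_mul' _ _ ENNReal.ofReal_ne_top]
        have h1 := aux_dil r L (fun v => |g v - g (t * v)| ^ r) (t ^ k) (by positivity)
          (pow_le_one₀ ht0.le (by linarith))
        calc _ ≤ _ := mul_le_mul_right h1 _
          _ = ENNReal.ofReal (K * Q ^ k * (t ^ k) ^ (r - 2)) * D := by
            rw [← mul_assoc, ← ENNReal.ofReal_mul (by positivity)]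
          _ ≤ ENNReal.ofReal (K * Q⁻¹ ^ k) * D := by
            apply mul_le_mul_left
            apply ENNReal.ofReal_le_ofReal
            have h3 : (t ^ k) ^ (r - 2) = (t ^ (r - 2)) ^ k := by
              rw [← Real.rpow_natCast, ← Real.rpow_natCast, ← Real.rpow_mul ht0.le,
                ← Real.rpow_mul ht0.le, mul_comm]
            rw [h3, mul_assoc, ← mul_pow]
            gcongr
          _ = _ := by
            rw [ENNReal.ofReal_mul hK.le, ENNReal.ofReal_pow hρ0.le]; ring
    _ = _ := by
        rw [ENNReal.tsum_mul_left, ENNReal.tsum_geometric, ENNReal.ofReal_mul hK.le,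
          ENNReal.ofReal_inv_of_pos (x := 1 - Q⁻¹) (by linarith), ENNReal.ofReal_sub _ hρ0.le, ENNReal.ofReal_one]
        ring

lemma aux_hardy (r : ℝ) (hr : 2 < r) : ∃ C > (0:ℝ), ∀ g : ℝ → ℝ, Measurable g →
    ContinuousAt g 0 → ∀ L : ℝ,
    ∫⁻ w in Ioo (0:ℝ) L, ENNReal.ofReal (|g w - g 0| ^ r * w ^ (1 - r)) ≤
      ENNReal.ofReal C *
        ∫⁻ y in Ioo (0:ℝ) L, ∫⁻ z in Ioo (0:ℝ) L,
          ENNReal.ofReal (|g y - g z| ^ r / |y - z| ^ r) := by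
  obtain ⟨C, hC, h⟩ := aux_hardy_t r hr
  refine ⟨4 * C, by positivity, ?_⟩
  intro g hgm hg L
  set A := ∫⁻ w in Ioo (0:ℝ) L, ENNReal.ofReal (|g w - g 0| ^ r * w ^ (1 - r))
  set E := ∫⁻ y in Ioo (0:ℝ) L, ∫⁻ z in Ioo (0:ℝ) L,
          ENNReal.ofReal (|g y - g z| ^ r / |y - z| ^ r)
  have key : A * ENNReal.ofReal (1 / 4) ≤ ENNReal.ofReal C * E := by
    calc _ = ∫⁻ t in Ioo (1 / 4 : ℝ) (1 / 2), A := by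
          rw [setLIntegral_const, Real.volume_Ioo]; norm_num
      _ ≤ ∫⁻ t in Ioo (1 / 4 : ℝ) (1 / 2), ENNReal.ofReal C *
        ∫⁻ w in Ioo (0:ℝ) L, ENNReal.ofReal (|g w - g (t * w)| ^ r * w ^ (1 - r)) := by
          apply setLIntegral_mono' measurableSet_Ioo
          intro t ht
          exact h g hgm hg t L (by linarith [ht.1]) ht.2
      _ = ENNReal.ofReal C * ∫⁻ w in Ioo (0:ℝ) L, ∫⁻ t in Ioo (1 / 4 : ℝ) (1 / 2),
          ENNReal.ofReal (|g w - g (t * w)| ^ r * w ^ (1 - r)) := by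
          rw [lintegral_const_mul' _ _ ENNReal.ofReal_ne_top, lintegral_lintegral_swap]
          apply Measurable.aemeasurable
          unfold Function.uncurry
          fun_prop
      _ ≤ _ := by
          apply mul_le_mul_right
          apply setLIntegral_mono' measurableSet_Ioo
          intro w hw
          have hw0 : 0 < w := hw.1
          set G : ℝ → ENNReal := (Ioo (0:ℝ) L).indicator
            (fun z => ENNReal.ofReal (|g w - g z| ^ r / |w - z| ^ r)) with hG
          have e1 : ∫⁻ t, ENNReal.ofReal w * G (w * t) = ∫⁻ z, G z := by
            rw [lintegral_const_mul' _ _ ENNReal.ofReal_ne_top, aux_scale G w hw0, ← mul_assoc,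
              ← ENNReal.ofReal_mul hw0.le, mul_inv_cancel₀ hw0.ne']
            simp
          rw [← lintegral_indicator measurableSet_Ioo, ← lintegral_indicator measurableSet_Ioo,
            ← hG, ← e1]
          apply lintegral_mono
          intro t
          by_cases ht : t ∈ Ioo (1 / 4 : ℝ) (1 / 2)
          · have ht0 : 0 < t := by linarith [ht.1]
            have ht2 := ht.2
            have hm : w * t ∈ Ioo (0:ℝ) L := ⟨by positivity, by nlinarith [hw.2]⟩
            simp only [indicator_of_mem ht, hG, indicator_of_mem hm]
            rw [← ENNReal.ofReal_mul hw0.le]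
            apply ENNReal.ofReal_le_ofReal
            rw [mul_comm t w]
            have hd : 0 < w - w * t := by nlinarith
            have hd2 : w - w * t ≤ w := by nlinarith
            rw [abs_of_pos hd, Real.rpow_sub hw0, Real.rpow_one]
            calc |g w - g (w * t)| ^ r * (w / w ^ r)
                ≤ |g w - g (w * t)| ^ r * (w / (w - w * t) ^ r) := by
                  have := Real.rpow_le_rpow hd.le hd2 (by linarith : 0 ≤ r)
                  have := Real.rpow_pos_of_pos hd r
                  gcongr
              _ = _ := by ring
          · rw [indicator_of_notMem ht]; exact zero_le
  calc A = 4 * (A * ENNReal.ofReal (1 / 4)) := by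
        rw [mul_comm A, ← mul_assoc, show (4 : ENNReal) = ENNReal.ofReal 4 by simp,
          ← ENNReal.ofReal_mul (by norm_num)]
        norm_num
    _ ≤ 4 * (ENNReal.ofReal C * E) := mul_le_mul_right key _
    _ = _ := by
        rw [ENNReal.ofReal_mul (by norm_num), mul_assoc]; simp

lemma aux_refl (τ : ℝ) (F : ℝ → ENNReal) :
    ∫⁻ z in Ioo (0:ℝ) τ, F z = ∫⁻ z in Ioo (0:ℝ) τ, F (τ - z) := by
  rw [← lintegral_indicator measurableSet_Ioo, ← lintegral_indicator measurableSet_Ioo,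
    ← lintegral_sub_left_eq_self _ τ]
  congr 1; ext z
  by_cases hz : z ∈ Ioo (0:ℝ) τ
  · have : τ - z ∈ Ioo (0:ℝ) τ := ⟨by linarith [hz.2], by linarith [hz.1]⟩
    rw [indicator_of_mem hz, indicator_of_mem this]
  · have : τ - z ∉ Ioo (0:ℝ) τ := fun h => hz ⟨by linarith [h.2], by linarith [h.1]⟩
    rw [indicator_of_notMem hz, indicator_of_notMem this]

lemma aux_split (τ : ℝ) (hτ : 0 < τ) (F : ℝ → ENNReal) :
    ∫⁻ z in Ioo (0:ℝ) (2 * τ), F z =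
      (∫⁻ z in Ioo (0:ℝ) τ, F z) + ∫⁻ z in Ioo (0:ℝ) τ, F (z + τ) := by
  have hu : Ioo (0:ℝ) (2 * τ) = Ioc 0 τ ∪ Ioo τ (2 * τ) :=
    (Ioc_union_Ioo_eq_Ioo hτ.le (by linarith)).symm
  have hd : Disjoint (Ioc (0:ℝ) τ) (Ioo τ (2 * τ)) := by
    rw [Set.disjoint_left]; intro x h1 h2; linarith [h1.2, h2.1]
  rw [hu, lintegral_union measurableSet_Ioo hd, setLIntegral_congr (Ioo_ae_eq_Ioc (a := (0:ℝ)) (b := τ))]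
  congr 1
  rw [← lintegral_indicator measurableSet_Ioo, ← lintegral_indicator measurableSet_Ioo,
    ← lintegral_add_right_eq_self ((Ioo τ (2 * τ)).indicator _) τ]
  congr 1; ext z
  by_cases hz : z ∈ Ioo (0:ℝ) τ
  · have : z + τ ∈ Ioo τ (2 * τ) := ⟨by linarith [hz.1], by linarith [hz.2]⟩
    rw [indicator_of_mem hz, indicator_of_mem this]
  · have : z + τ ∉ Ioo τ (2 * τ) := fun h => hz ⟨by linarith [h.1], by linarith [h.2]⟩
    rw [indicator_of_notMem hz, indicator_of_notMem this]

lemma aux_tail (r τ a : ℝ) (hr : 2 < r) (ha : 0 < a) :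
    ∫⁻ x in Ioo (0:ℝ) τ, ENNReal.ofReal (1 / |x + a| ^ r) ≤
      ENNReal.ofReal (a ^ (1 - r) / (r - 1)) := by
  have h1 := integral_Ioi_rpow_of_lt (a := -r) (by linarith) ha
  have h2 := integrableOn_Ioi_rpow_of_lt (a := -r) (by linarith) ha
  have h3 := ofReal_integral_eq_lintegral_ofReal h2 (by
    filter_upwards [ae_restrict_mem measurableSet_Ioi] with x hx
    have : 0 < x := ha.trans hx
    simp only [Pi.zero_apply]; positivity)
  rw [h1] at h3
  have h4 : a ^ (1 - r) / (r - 1) = -a ^ (-r + 1) / (-r + 1) := by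
    rw [show -r + 1 = -(r - 1) by ring, neg_div_neg_eq, neg_sub]
  rw [h4, h3, ← lintegral_indicator measurableSet_Ioo, ← lintegral_indicator measurableSet_Ioi,
    ← lintegral_add_right_eq_self ((Ioi a).indicator _) a]
  apply lintegral_mono
  intro x
  by_cases hx : x ∈ Ioo (0:ℝ) τ
  · have hx2 : x + a ∈ Ioi a := by simp only [mem_Ioi]; linarith [hx.1]
    have : 0 < x + a := by linarith [hx.1]
    simp only [indicator_of_mem hx, indicator_of_mem hx2]
    rw [abs_of_pos this, Real.rpow_neg this.le, one_div]
  · rw [indicator_of_notMem hx]; exact zero_le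

lemma aux_cross (r τ : ℝ) (hr : 2 < r) :
    ∃ C > (0:ℝ), ∀ g : ℝ → ℝ, Measurable g →
      ContinuousAt g 0 → ContinuousAt g τ → g 0 = g τ →
      (∫⁻ y in Ioo (0:ℝ) τ, ∫⁻ z in Ioo (0:ℝ) τ,
          ENNReal.ofReal (|g y - g z| ^ r / |y + τ - z| ^ r))
        ≤ ENNReal.ofReal C *
          ∫⁻ y in Ioo (0:ℝ) τ, ∫⁻ z in Ioo (0:ℝ) τ,
            ENNReal.ofReal (|g y - g z| ^ r / |y - z| ^ r) := by
  obtain ⟨K, hK, h⟩ := aux_two_pt r 2 hr (by norm_num)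
  obtain ⟨C, hC, hH⟩ := aux_hardy r hr
  have hr1 : 0 < r - 1 := by linarith
  refine ⟨K * C / (r - 1) + 2 * C / (r - 1), by positivity, ?_⟩
  intro g hgm hg0 hgτ hgg
  set E := ∫⁻ y in Ioo (0:ℝ) τ, ∫⁻ z in Ioo (0:ℝ) τ,
            ENNReal.ofReal (|g y - g z| ^ r / |y - z| ^ r) with hE
  have H0 := hH g hgm hg0 τ
  have H1 : ∫⁻ z in Ioo (0:ℝ) τ, ENNReal.ofReal (|g z - g 0| ^ r * (τ - z) ^ (1 - r)) ≤
      ENNReal.ofReal C * E := by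
    have := hH (fun x => g (τ - x)) (by fun_prop) (by
      apply ContinuousAt.comp (g := g)
      · simpa using hgτ
      · fun_prop) τ
    have e : E = ∫⁻ y in Ioo (0:ℝ) τ, ∫⁻ z in Ioo (0:ℝ) τ,
            ENNReal.ofReal (|g (τ - y) - g (τ - z)| ^ r / |y - z| ^ r) := by
      rw [hE, aux_refl]
      congr 1; ext y
      rw [aux_refl]
      congr 1; ext z
      rw [show τ - y - (τ - z) = -(y - z) by ring, abs_neg]
    rw [e]
    refine le_trans (le_of_eq ?_) this
    rw [aux_refl]
    congr 1; ext z
    rw [sub_zero, sub_sub_cancel, hgg]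
  have P1 : ∫⁻ y in Ioo (0:ℝ) τ, ∫⁻ z in Ioo (0:ℝ) τ,
      ENNReal.ofReal (K * |g y - g 0| ^ r) * ENNReal.ofReal (1 / |y + τ - z| ^ r) ≤
      ENNReal.ofReal (K * C / (r - 1)) * E := by
    calc _ ≤ ∫⁻ y in Ioo (0:ℝ) τ, ENNReal.ofReal (K / (r - 1)) *
            ENNReal.ofReal (|g y - g 0| ^ r * y ^ (1 - r)) := by
          apply setLIntegral_mono' measurableSet_Ioo
          intro y hy
          rw [lintegral_const_mul' _ _ ENNReal.ofReal_ne_top, aux_refl]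
          have ht := aux_tail r τ y hr hy.1
          have e : ∀ z, y + τ - (τ - z) = z + y := fun z => by ring
          simp only [e]
          calc _ ≤ _ := mul_le_mul_right ht _
            _ = _ := by
              rw [← ENNReal.ofReal_mul (by positivity), ← ENNReal.ofReal_mul (by positivity)]
              congr 1; ring
      _ ≤ ENNReal.ofReal (K / (r - 1)) * (ENNReal.ofReal C * E) := by
          rw [lintegral_const_mul' _ _ ENNReal.ofReal_ne_top]
          exact mul_le_mul_right H0 _
      _ = _ := by
          rw [← mul_assoc, ← ENNReal.ofReal_mul (by positivity)]
          congr 2; ring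
  have P2 : ∫⁻ y in Ioo (0:ℝ) τ, ∫⁻ z in Ioo (0:ℝ) τ,
      ENNReal.ofReal (2 * |g z - g 0| ^ r) * ENNReal.ofReal (1 / |y + τ - z| ^ r) ≤
      ENNReal.ofReal (2 * C / (r - 1)) * E := by
    rw [lintegral_lintegral_swap (by
      apply Measurable.aemeasurable
      unfold Function.uncurry
      fun_prop)]
    calc _ ≤ ∫⁻ z in Ioo (0:ℝ) τ, ENNReal.ofReal (2 / (r - 1)) *
            ENNReal.ofReal (|g z - g 0| ^ r * (τ - z) ^ (1 - r)) := by
          apply setLIntegral_mono' measurableSet_Ioo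
          intro z hz
          rw [lintegral_const_mul' _ _ ENNReal.ofReal_ne_top]
          have ht := aux_tail r τ (τ - z) hr (by linarith [hz.2])
          simp only [add_sub_assoc]
          calc _ ≤ _ := mul_le_mul_right ht _
            _ = _ := by
              rw [← ENNReal.ofReal_mul (by positivity), ← ENNReal.ofReal_mul (by positivity)]
              congr 1; ring
      _ ≤ ENNReal.ofReal (2 / (r - 1)) * (ENNReal.ofReal C * E) := by
          rw [lintegral_const_mul' _ _ ENNReal.ofReal_ne_top]
          exact mul_le_mul_right H1 _
      _ = _ := by
          rw [← mul_assoc, ← ENNReal.ofReal_mul (by positivity)]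
          congr 2; ring
  calc _ ≤ ∫⁻ y in Ioo (0:ℝ) τ, ∫⁻ z in Ioo (0:ℝ) τ,
      (ENNReal.ofReal (K * |g y - g 0| ^ r) * ENNReal.ofReal (1 / |y + τ - z| ^ r) +
       ENNReal.ofReal (2 * |g z - g 0| ^ r) * ENNReal.ofReal (1 / |y + τ - z| ^ r)) := by
        apply lintegral_mono; intro y
        apply lintegral_mono; intro z
        dsimp only
        rw [← add_mul, ← ENNReal.ofReal_add (by positivity) (by positivity),
          ← ENNReal.ofReal_mul (by positivity), mul_one_div]
        apply ENNReal.ofReal_le_ofReal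
        gcongr
        calc |g y - g z| ^ r ≤ (|g y - g 0| + |g z - g 0|) ^ r := by
              apply Real.rpow_le_rpow (abs_nonneg _) _ (by linarith)
              rw [abs_sub_comm (g z)]; exact abs_sub_le _ _ _
          _ ≤ _ := h _ _ (abs_nonneg _) (abs_nonneg _)
    _ = _ := by
        rw [← lintegral_add_left]
        · congr 1; ext y
          rw [← lintegral_add_left]
          fun_prop
        · apply Measurable.lintegral_prod_right
          fun_prop
    _ ≤ _ := add_le_add P1 P2
    _ = _ := by
        rw [← add_mul, ← ENNReal.ofReal_add (by positivity) (by positivity)]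

/-- the `τ`-periodic extension of `g` from `[0,τ]` to `[0,2τ]` has Gagliardo
seminorm (of order `1-1/r`, exponent `r`, so `1 + sr = r`) controlled by that of `g`,
with a constant depending only on `r` and `τ`. -/
theorem stmt_5 (r τ : ℝ) (hr : 2 < r) (hτ : 0 < τ) :
    ∃ C > (0:ℝ), ∀ g : ℝ → ℝ, Measurable g →
      ContinuousAt g 0 → ContinuousAt g τ → g 0 = g τ →
      (∫⁻ y in Ioo (0:ℝ) τ, ∫⁻ z in Ioo (0:ℝ) τ,
          ENNReal.ofReal (|g y - g z| ^ r / |y - z| ^ r)) < ⊤ →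
      (∫⁻ y in Ioo (0:ℝ) (2*τ), ∫⁻ z in Ioo (0:ℝ) (2*τ),
          ENNReal.ofReal (|(if y ≤ τ then g y else g (y - τ)) -
            (if z ≤ τ then g z else g (z - τ))| ^ r / |y - z| ^ r))
        ≤ ENNReal.ofReal C *
          ∫⁻ y in Ioo (0:ℝ) τ, ∫⁻ z in Ioo (0:ℝ) τ,
            ENNReal.ofReal (|g y - g z| ^ r / |y - z| ^ r) := by
  obtain ⟨C, hC, hX⟩ := aux_cross r τ hr
  refine ⟨2 + 2 * C, by positivity, ?_⟩
  intro g hgm hg0 hgτ hgg _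
  have hX2 := hX g hgm hg0 hgτ hgg
  set E := ∫⁻ y in Ioo (0:ℝ) τ, ∫⁻ z in Ioo (0:ℝ) τ,
            ENNReal.ofReal (|g y - g z| ^ r / |y - z| ^ r) with hE
  set X := ∫⁻ y in Ioo (0:ℝ) τ, ∫⁻ z in Ioo (0:ℝ) τ,
          ENNReal.ofReal (|g y - g z| ^ r / |y + τ - z| ^ r) with hXd
  have hXs : ∫⁻ y in Ioo (0:ℝ) τ, ∫⁻ z in Ioo (0:ℝ) τ,
          ENNReal.ofReal (|g y - g z| ^ r / |y - (z + τ)| ^ r) = X := by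
    rw [lintegral_lintegral_swap (by
      apply Measurable.aemeasurable
      unfold Function.uncurry
      fun_prop)]
    simp only [hXd]
    congr 1; ext y; congr 1; ext z
    rw [abs_sub_comm (g z), abs_sub_comm z]
  have A1 : ∀ y ∈ Ioo (0:ℝ) τ, ∫⁻ z in Ioo (0:ℝ) (2*τ),
          ENNReal.ofReal (|(if y ≤ τ then g y else g (y - τ)) -
            (if z ≤ τ then g z else g (z - τ))| ^ r / |y - z| ^ r) =
      (∫⁻ z in Ioo (0:ℝ) τ, ENNReal.ofReal (|g y - g z| ^ r / |y - z| ^ r)) +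
      ∫⁻ z in Ioo (0:ℝ) τ, ENNReal.ofReal (|g y - g z| ^ r / |y - (z + τ)| ^ r) := by
    intro y hy
    rw [aux_split τ hτ, if_pos hy.2.le]
    congr 1
    · apply setLIntegral_congr_fun measurableSet_Ioo
      intro z hz
      simp only [if_pos hz.2.le]
    · apply setLIntegral_congr_fun measurableSet_Ioo
      intro z hz
      simp only [if_neg (by linarith [hz.1] : ¬ z + τ ≤ τ), add_sub_cancel_right]
  have A2 : ∀ y ∈ Ioo (0:ℝ) τ, ∫⁻ z in Ioo (0:ℝ) (2*τ),
          ENNReal.ofReal (|(if y + τ ≤ τ then g (y + τ) else g (y + τ - τ)) -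
            (if z ≤ τ then g z else g (z - τ))| ^ r / |y + τ - z| ^ r) =
      (∫⁻ z in Ioo (0:ℝ) τ, ENNReal.ofReal (|g y - g z| ^ r / |y + τ - z| ^ r)) +
      ∫⁻ z in Ioo (0:ℝ) τ, ENNReal.ofReal (|g y - g z| ^ r / |y - z| ^ r) := by
    intro y hy
    rw [aux_split τ hτ, if_neg (by linarith [hy.1] : ¬ y + τ ≤ τ), add_sub_cancel_right]
    congr 1
    · apply setLIntegral_congr_fun measurableSet_Ioo
      intro z hz
      simp only [if_pos hz.2.le]
    · apply setLIntegral_congr_fun measurableSet_Ioo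
      intro z hz
      simp only [if_neg (by linarith [hz.1] : ¬ z + τ ≤ τ), add_sub_cancel_right,
        add_sub_add_right_eq_sub]
  rw [aux_split τ hτ, setLIntegral_congr_fun measurableSet_Ioo A1,
    setLIntegral_congr_fun measurableSet_Ioo A2, lintegral_add_left, lintegral_add_left,
    hXs, ← hE, ← hXd]
  · calc E + X + (X + E) = 2 * E + 2 * X := by ring
      _ ≤ 2 * E + 2 * (ENNReal.ofReal C * E) := by gcongr
      _ = _ := by
        rw [ENNReal.ofReal_add (by norm_num) (by positivity), ENNReal.ofReal_mul (by norm_num)]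
        simp; ring
  · apply Measurable.lintegral_prod_right
    fun_prop
  · apply Measurable.lintegral_prod_right
    fun_prop
end

section
/- (Fractional Hardy inequality, one-dimensional case used in the paper) Let r > 2 and g : (0,τ) → ℝ measurable with finite Gagliardo seminorm ⟨g⟩_{1−1/r,r;(0,τ)} and a well-defined boundary value g(τ) (trace at the endpoint). Then ∫_0^τ |g(z) − g(τ)|^r / (τ − z)^{r−1} dz ≤ C ∫_0^τ∫_0^τ |g(x) − g(z)|^r / |x − z|^r dx dz with C depending only on r. -/
open MeasureTheory Set

lemma aux_convex (r q a b : ℝ) (hr : 2 < r) (hq0 : 0 < q) (hq1 : q < 1) (ha : 0 ≤ a) (hb : 0 ≤ b) :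
    (a + b) ^ r ≤ (1 - q) ^ (1 - r) * a ^ r + q ^ (1 - r) * b ^ r := by
  have h1q : 0 < 1 - q := by linarith
  have key := (convexOn_rpow (by linarith : 1 ≤ r)).2
    (mem_Ici.mpr (by positivity : 0 ≤ a / (1 - q))) (mem_Ici.mpr (by positivity : 0 ≤ b / q))
    h1q.le hq0.le (by ring)
  simp only [smul_eq_mul] at key
  have e1 : (1 - q) * (a / (1 - q)) + q * (b / q) = a + b := by field_simp
  rw [e1, Real.div_rpow ha h1q.le, Real.div_rpow hb hq0.le] at key
  rw [Real.rpow_sub h1q, Real.rpow_sub hq0, Real.rpow_one, Real.rpow_one]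
  calc _ ≤ _ := key
    _ = _ := by ring

lemma aux_comp_mul (G : ℝ → ENNReal) (hG : Measurable G) (s : ℝ) (hs : 0 < s) :
    ENNReal.ofReal s * ∫⁻ t, G (s * t) = ∫⁻ u, G u := by
  have h1 := Real.map_volume_mul_left hs.ne'
  have h2 : ∫⁻ t, G (s * t) = ∫⁻ u, G u ∂(Measure.map (s * ·) volume) :=
    (lintegral_map hG (measurable_const_mul s)).symm
  rw [h2, h1, lintegral_smul_measure, smul_eq_mul, ← mul_assoc, ← ENNReal.ofReal_mul hs.le,
    abs_of_pos (inv_pos.mpr hs), mul_inv_cancel₀ hs.ne', ENNReal.ofReal_one, one_mul]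

lemma aux_scale_s6 (r τ s : ℝ) (hs0 : 0 < s) (hs1 : s < 1)
    (F : ℝ → ℝ) (hF : Measurable F) (hF0 : ∀ t, 0 ≤ F t) :
    ∫⁻ t in Ioo (0:ℝ) τ, ENNReal.ofReal (F (s * t) * t ^ (1 - r)) ≤
      ENNReal.ofReal (s ^ (r - 2)) *
        ∫⁻ t in Ioo (0:ℝ) τ, ENNReal.ofReal (F t * t ^ (1 - r)) := by
  set G : ℝ → ENNReal := (Ioo (0:ℝ) τ).indicator (fun t => ENNReal.ofReal (F t * t ^ (1 - r)))
    with hGdef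
  have hG : Measurable G := by
    apply Measurable.indicator _ measurableSet_Ioo
    fun_prop
  have e : ∫⁻ t in Ioo (0:ℝ) τ, ENNReal.ofReal (F t * t ^ (1 - r)) = ∫⁻ t, G t :=
    (lintegral_indicator measurableSet_Ioo _).symm
  rw [e, ← aux_comp_mul G hG s hs0, ← mul_assoc, ← ENNReal.ofReal_mul (by positivity),
    ← lintegral_const_mul' _ _ ENNReal.ofReal_ne_top]
  refine le_trans ?_ (setLIntegral_le_lintegral (Ioo (0:ℝ) τ) _)
  refine setLIntegral_mono' measurableSet_Ioo ?_
  intro t ht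
  have hst : s * t ∈ Ioo (0:ℝ) τ := ⟨mul_pos hs0 ht.1, by nlinarith [ht.1, ht.2]⟩
  rw [hGdef, indicator_of_mem hst, ← ENNReal.ofReal_mul (by positivity)]
  apply ENNReal.ofReal_le_ofReal
  apply le_of_eq
  rw [Real.mul_rpow hs0.le ht.1.le]
  have : s ^ (r - 2) * s * s ^ (1 - r) = 1 := by
    rw [← Real.rpow_add_one hs0.ne', ← Real.rpow_add hs0]
    ring_nf
    simp
  calc _ = (s ^ (r - 2) * s * s ^ (1 - r)) * (F (s * t) * t ^ (1 - r)) := by rw [this, one_mul]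
    _ = _ := by ring

lemma aux_step (r : ℝ) (hr : 2 < r) (q : ℝ) (hq : q = (1 / 2 : ℝ) ^ ((r - 2) / r))
    (τ s : ℝ) (hs0 : 0 < s) (hs1 : s < 1 / 2) (h : ℝ → ℝ) (hm : Measurable h) (n : ℕ) :
    ∫⁻ t in Ioo (0:ℝ) τ, ENNReal.ofReal (|h t - h (s ^ n * t)| ^ r * t ^ (1 - r)) ≤
      ENNReal.ofReal ((1 - q) ^ (1 - r) / (1 - q)) *
        ∫⁻ t in Ioo (0:ℝ) τ, ENNReal.ofReal (|h t - h (s * t)| ^ r * t ^ (1 - r)) := by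
  have hr0 : 0 < r := by linarith
  have hq0 : 0 < q := by rw [hq]; positivity
  have hq1 : q < 1 := by
    rw [hq]; exact Real.rpow_lt_one (by norm_num) (by norm_num) (div_pos (by linarith) hr0)
  have h1q : 0 < 1 - q := by linarith
  have hA : 0 < (1 - q) ^ (1 - r) := by positivity
  have hqs : q ^ (1 - r) * s ^ (r - 2) ≤ q := by
    have h1 : s ^ (r - 2) ≤ q ^ r := by
      rw [hq, ← Real.rpow_mul (by norm_num), div_mul_cancel₀ _ hr0.ne']
      exact Real.rpow_le_rpow hs0.le hs1.le (by linarith)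
    calc _ ≤ q ^ (1 - r) * q ^ r := by gcongr
      _ = q := by rw [← Real.rpow_add hq0]; simp
  induction n with
  | zero => simp [Real.zero_rpow hr0.ne']
  | succ n ih =>
    set E := ∫⁻ t in Ioo (0:ℝ) τ, ENNReal.ofReal (|h t - h (s * t)| ^ r * t ^ (1 - r)) with hE
    set J := ∫⁻ t in Ioo (0:ℝ) τ, ENNReal.ofReal (|h t - h (s ^ n * t)| ^ r * t ^ (1 - r)) with hJ
    have hsc := aux_scale_s6 r τ s hs0 (by linarith) (fun t => |h t - h (s ^ n * t)| ^ r)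
      (by fun_prop) (fun t => by positivity)
    calc _ ≤ ∫⁻ t in Ioo (0:ℝ) τ,
          (ENNReal.ofReal ((1 - q) ^ (1 - r)) *
            ENNReal.ofReal (|h t - h (s * t)| ^ r * t ^ (1 - r)) +
          ENNReal.ofReal (q ^ (1 - r)) *
            ENNReal.ofReal (|h (s * t) - h (s ^ n * (s * t))| ^ r * t ^ (1 - r))) := by
          refine setLIntegral_mono' measurableSet_Ioo ?_
          intro t ht
          have ht0 : 0 < t := ht.1
          rw [← ENNReal.ofReal_mul (by positivity), ← ENNReal.ofReal_mul (by positivity),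
            ← ENNReal.ofReal_add (by positivity) (by positivity)]
          apply ENNReal.ofReal_le_ofReal
          have e : s ^ (n + 1) * t = s ^ n * (s * t) := by ring
          rw [e]
          have tri : |h t - h (s ^ n * (s * t))| ≤
              |h t - h (s * t)| + |h (s * t) - h (s ^ n * (s * t))| := abs_sub_le _ _ _
          have := (Real.rpow_le_rpow (abs_nonneg _) tri hr0.le).trans
            (aux_convex r q _ _ hr hq0 hq1 (abs_nonneg _) (abs_nonneg _))
          calc _ ≤ _ := mul_le_mul_of_nonneg_right this (by positivity : 0 ≤ t ^ (1 - r))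
            _ = _ := by ring
      _ = ENNReal.ofReal ((1 - q) ^ (1 - r)) * E + ENNReal.ofReal (q ^ (1 - r)) *
            ∫⁻ t in Ioo (0:ℝ) τ,
              ENNReal.ofReal (|h (s * t) - h (s ^ n * (s * t))| ^ r * t ^ (1 - r)) := by
          rw [lintegral_add_left (by fun_prop), lintegral_const_mul' _ _ ENNReal.ofReal_ne_top,
            lintegral_const_mul' _ _ ENNReal.ofReal_ne_top]
      _ ≤ ENNReal.ofReal ((1 - q) ^ (1 - r)) * E + ENNReal.ofReal (q ^ (1 - r)) *
            (ENNReal.ofReal (s ^ (r - 2)) *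
              (ENNReal.ofReal ((1 - q) ^ (1 - r) / (1 - q)) * E)) := by
          gcongr
          exact hsc.trans (by gcongr)
      _ = ENNReal.ofReal ((1 - q) ^ (1 - r) + q ^ (1 - r) * s ^ (r - 2) *
            ((1 - q) ^ (1 - r) / (1 - q))) * E := by
          rw [ENNReal.ofReal_add (by positivity) (by positivity), ENNReal.ofReal_mul (by positivity),
            ENNReal.ofReal_mul (by positivity)]
          ring
      _ ≤ _ := by
          gcongr
          calc _ ≤ (1 - q) ^ (1 - r) + q * ((1 - q) ^ (1 - r) / (1 - q)) := by gcongr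
            _ = _ := by field_simp; ring

lemma aux_key (r : ℝ) (hr : 2 < r) (q : ℝ) (hq : q = (1 / 2 : ℝ) ^ ((r - 2) / r))
    (τ s : ℝ) (hs0 : 0 < s) (hs1 : s < 1 / 2) (h : ℝ → ℝ) (hm : Measurable h)
    (hlim : Filter.Tendsto h (nhdsWithin 0 (Ioo 0 τ)) (nhds 0)) :
    ∫⁻ t in Ioo (0:ℝ) τ, ENNReal.ofReal (|h t| ^ r * t ^ (1 - r)) ≤
      ENNReal.ofReal ((1 - q) ^ (1 - r) / (1 - q)) *
        ∫⁻ t in Ioo (0:ℝ) τ, ENNReal.ofReal (|h t - h (s * t)| ^ r * t ^ (1 - r)) := by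
  have hr0 : 0 < r := by linarith
  calc _ = ∫⁻ t in Ioo (0:ℝ) τ, Filter.liminf (fun n : ℕ =>
        ENNReal.ofReal (|h t - h (s ^ n * t)| ^ r * t ^ (1 - r))) Filter.atTop := by
        refine setLIntegral_congr_fun measurableSet_Ioo ?_
        intro t ht
        symm
        apply Filter.Tendsto.liminf_eq
        apply ENNReal.tendsto_ofReal
        apply Filter.Tendsto.mul_const
        apply Filter.Tendsto.rpow_const _ (Or.inr hr0.le)
        apply Filter.Tendsto.abs
        have hp : Filter.Tendsto (fun n : ℕ => s ^ n * t) Filter.atTop (nhds 0) := by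
          have := (tendsto_pow_atTop_nhds_zero_of_lt_one hs0.le (by linarith : s < 1)).mul_const t
          simpa using this
        have hp2 : Filter.Tendsto (fun n : ℕ => s ^ n * t) Filter.atTop
            (nhdsWithin 0 (Ioo 0 τ)) := by
          refine tendsto_nhdsWithin_iff.mpr ⟨hp, Filter.Eventually.of_forall fun n => ?_⟩
          have h1 : s ^ n ≤ 1 := pow_le_one₀ hs0.le (by linarith)
          have h2 : 0 < s ^ n := by positivity
          exact ⟨mul_pos h2 ht.1, by nlinarith [ht.1, ht.2]⟩
        have := (tendsto_const_nhds (x := h t)).sub (hlim.comp hp2)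
        simpa using this
    _ ≤ Filter.liminf (fun n : ℕ => ∫⁻ t in Ioo (0:ℝ) τ,
        ENNReal.ofReal (|h t - h (s ^ n * t)| ^ r * t ^ (1 - r))) Filter.atTop :=
        lintegral_liminf_le (fun n => by fun_prop)
    _ ≤ _ := by
        refine Filter.liminf_le_of_le (by isBoundedDefault) ?_
        intro b hb
        obtain ⟨n, hn⟩ := hb.exists
        exact hn.trans (aux_step r hr q hq τ s hs0 hs1 h hm n)

lemma aux_main (r : ℝ) (hr : 2 < r) (q : ℝ) (hq : q = (1 / 2 : ℝ) ^ ((r - 2) / r))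
    (τ : ℝ) (h : ℝ → ℝ) (hm : Measurable h)
    (hlim : Filter.Tendsto h (nhdsWithin 0 (Ioo 0 τ)) (nhds 0)) :
    ∫⁻ t in Ioo (0:ℝ) τ, ENNReal.ofReal (|h t| ^ r * t ^ (1 - r)) ≤
      ENNReal.ofReal (2 * ((1 - q) ^ (1 - r) / (1 - q))) *
        ∫⁻ x in Ioo (0:ℝ) τ, ∫⁻ z in Ioo (0:ℝ) τ,
            ENNReal.ofReal (|h x - h z| ^ r / |x - z| ^ r) := by
  have hr0 : 0 < r := by linarith
  set L := ∫⁻ t in Ioo (0:ℝ) τ, ENNReal.ofReal (|h t| ^ r * t ^ (1 - r))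
  set B := (1 - q) ^ (1 - r) / (1 - q)
  set M := ∫⁻ x in Ioo (0:ℝ) τ, ∫⁻ z in Ioo (0:ℝ) τ,
            ENNReal.ofReal (|h x - h z| ^ r / |x - z| ^ r)
  have h1 : ENNReal.ofReal (1 / 2) * L ≤ ENNReal.ofReal B * M := by
    calc ENNReal.ofReal (1 / 2) * L = ∫⁻ s in Ioo (0:ℝ) (1 / 2), L := by
          rw [setLIntegral_const, Real.volume_Ioo, mul_comm]; simp
      _ ≤ ∫⁻ s in Ioo (0:ℝ) (1 / 2), ENNReal.ofReal B *
            ∫⁻ t in Ioo (0:ℝ) τ, ENNReal.ofReal (|h t - h (s * t)| ^ r * t ^ (1 - r)) :=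
          setLIntegral_mono' measurableSet_Ioo
            (fun s hs => aux_key r hr q hq τ s hs.1 hs.2 h hm hlim)
      _ = ENNReal.ofReal B * ∫⁻ t in Ioo (0:ℝ) τ, ∫⁻ s in Ioo (0:ℝ) (1 / 2),
            ENNReal.ofReal (|h t - h (s * t)| ^ r * t ^ (1 - r)) := by
          rw [lintegral_const_mul' _ _ ENNReal.ofReal_ne_top, lintegral_lintegral_swap]
          apply Measurable.aemeasurable
          simp only [Function.uncurry_def]
          fun_prop
      _ ≤ ENNReal.ofReal B * M := by
          gcongr ENNReal.ofReal B * ?_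
          refine setLIntegral_mono' measurableSet_Ioo ?_
          intro t ht
          have ht0 : 0 < t := ht.1
          set G : ℝ → ENNReal := (Ioo (0:ℝ) τ).indicator
            (fun z => ENNReal.ofReal (|h t - h z| ^ r / |t - z| ^ r)) with hGdef
          have hG : Measurable G := by
            apply Measurable.indicator _ measurableSet_Ioo
            fun_prop
          rw [← lintegral_indicator measurableSet_Ioo
            (fun z => ENNReal.ofReal (|h t - h z| ^ r / |t - z| ^ r)), ← hGdef,
            ← aux_comp_mul G hG t ht0, ← lintegral_const_mul' _ _ ENNReal.ofReal_ne_top]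
          refine le_trans ?_ (setLIntegral_le_lintegral (Ioo (0:ℝ) (1 / 2)) _)
          refine setLIntegral_mono' measurableSet_Ioo ?_
          intro s hs
          have hs0 : 0 < s := hs.1
          have hs1 : s < 1 / 2 := hs.2
          have hst : t * s ∈ Ioo (0:ℝ) τ := ⟨mul_pos ht0 hs0, by nlinarith [ht.2]⟩
          rw [hGdef, indicator_of_mem hst, ← ENNReal.ofReal_mul ht0.le]
          apply ENNReal.ofReal_le_ofReal
          have hpos : 0 < t - t * s := by nlinarith
          rw [mul_comm s t, abs_of_pos hpos, Real.rpow_sub ht0, Real.rpow_one]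
          have hle : (t - t * s) ^ r ≤ t ^ r :=
            Real.rpow_le_rpow hpos.le (by nlinarith) hr0.le
          have hp2 : 0 < (t - t * s) ^ r := by positivity
          calc _ = t * (|h t - h (t * s)| ^ r / t ^ r) := by ring
            _ ≤ _ := by gcongr
  calc L = ENNReal.ofReal 2 * (ENNReal.ofReal (1 / 2) * L) := by
        rw [← mul_assoc, ← ENNReal.ofReal_mul (by norm_num)]; norm_num
    _ ≤ ENNReal.ofReal 2 * (ENNReal.ofReal B * M) := by gcongr
    _ = _ := by rw [← mul_assoc, ← ENNReal.ofReal_mul (by norm_num)]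

lemma aux_reflect (τ : ℝ) (F : ℝ → ENNReal) :
    ∫⁻ t in Ioo (0:ℝ) τ, F (τ - t) = ∫⁻ t in Ioo (0:ℝ) τ, F t := by
  rw [← lintegral_indicator measurableSet_Ioo, ← lintegral_indicator measurableSet_Ioo,
    ← lintegral_sub_left_eq_self _ τ]
  congr 1
  ext t
  simp only [indicator, mem_Ioo, sub_pos, sub_lt_self_iff, sub_sub_cancel]
  simp only [and_comm]

/-- the one-dimensional fractional Hardy inequality, with `s = 1 - 1/r`,
`r > 2`: the weighted distance of `g` to its endpoint value `g(τ)` is controlled by the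
Gagliardo seminorm, with a constant depending only on `r`. -/
theorem stmt_6 (r : ℝ) (hr : 2 < r) :
    ∃ C > (0:ℝ), ∀ τ > (0:ℝ), ∀ g : ℝ → ℝ, Measurable g →
      ContinuousWithinAt g (Ioo 0 τ) τ →
      (∫⁻ x in Ioo (0:ℝ) τ, ∫⁻ z in Ioo (0:ℝ) τ,
          ENNReal.ofReal (|g x - g z| ^ r / |x - z| ^ r)) < ⊤ →
      (∫⁻ z in Ioo (0:ℝ) τ, ENNReal.ofReal (|g z - g τ| ^ r / (τ - z) ^ (r - 1)))
        ≤ ENNReal.ofReal C *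
          ∫⁻ x in Ioo (0:ℝ) τ, ∫⁻ z in Ioo (0:ℝ) τ,
            ENNReal.ofReal (|g x - g z| ^ r / |x - z| ^ r) := by
  have hr0 : 0 < r := by linarith
  obtain ⟨q, hq⟩ : ∃ q, q = (1 / 2 : ℝ) ^ ((r - 2) / r) := ⟨_, rfl⟩
  have hq1 : q < 1 := by
    rw [hq]; exact Real.rpow_lt_one (by norm_num) (by norm_num) (div_pos (by linarith) hr0)
  have h1q : 0 < 1 - q := by linarith
  refine ⟨2 * ((1 - q) ^ (1 - r) / (1 - q)), by positivity, ?_⟩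
  intro τ hτ g hg hc _
  have hlim : Filter.Tendsto (fun t => g (τ - t) - g τ) (nhdsWithin 0 (Ioo 0 τ)) (nhds 0) := by
    have h1 : Filter.Tendsto (fun t : ℝ => τ - t) (nhdsWithin 0 (Ioo 0 τ))
        (nhdsWithin τ (Ioo 0 τ)) := by
      refine tendsto_nhdsWithin_iff.mpr ⟨?_, ?_⟩
      · have : Filter.Tendsto (fun t : ℝ => τ - t) (nhds 0) (nhds (τ - 0)) :=
          (continuous_const.sub continuous_id).tendsto 0
        rw [sub_zero] at this
        exact this.mono_left nhdsWithin_le_nhds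
      · filter_upwards [self_mem_nhdsWithin] with t ht
        exact ⟨by linarith [ht.2], by linarith [ht.1]⟩
    have h2 := (hc.tendsto.comp h1).sub (tendsto_const_nhds (x := g τ))
    simpa using h2
  have main := aux_main r hr q hq τ (fun t => g (τ - t) - g τ) (by fun_prop) hlim
  have eL : ∫⁻ z in Ioo (0:ℝ) τ, ENNReal.ofReal (|g z - g τ| ^ r / (τ - z) ^ (r - 1)) =
      ∫⁻ t in Ioo (0:ℝ) τ, ENNReal.ofReal (|g (τ - t) - g τ| ^ r * t ^ (1 - r)) := by
    rw [← aux_reflect]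
    refine setLIntegral_congr_fun measurableSet_Ioo ?_
    intro t ht
    have : t ^ (1 - r) = (t ^ (r - 1))⁻¹ := by
      rw [← Real.rpow_neg ht.1.le, neg_sub]
    simp only [sub_sub_cancel, this, div_eq_mul_inv]
  have eR : ∫⁻ x in Ioo (0:ℝ) τ, ∫⁻ z in Ioo (0:ℝ) τ,
        ENNReal.ofReal (|g x - g z| ^ r / |x - z| ^ r) =
      ∫⁻ x in Ioo (0:ℝ) τ, ∫⁻ z in Ioo (0:ℝ) τ,
        ENNReal.ofReal (|(g (τ - x) - g τ) - (g (τ - z) - g τ)| ^ r / |x - z| ^ r) := by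
    rw [← aux_reflect]
    refine lintegral_congr fun x => ?_
    rw [← aux_reflect]
    refine lintegral_congr fun z => ?_
    rw [sub_sub_sub_cancel_right, sub_sub_sub_cancel_left, abs_sub_comm z x]
  rw [eL, eR]
  exact main
end
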